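/- arXiv:1601.04998 — 4 statements merged into one kernel-verified Lean document; each statement's English description precedes it below -/
import Mathlib

section
/- Let R be a commutative ring, let a, b ∈ R³ represent points A, B and let λ, μ ∈ R³ represent lines l, m of the projective plane over R. If A and B are apart, l and m are apart, A lies on l, B lies on l, and B lies on m, then A lies outside m, i.e. μ₀a₀+μ₁a₁+μ₂a₂ is a unit. -/
/-- A vector in `R³` has at least one coordinate a unit, hence represents a point
(or line) of the projective plane over `R`. -/
def IsRep {R : Type*} [CommRing R] (a : Fin 3 → R) : Prop :=
  IsUnit (a 0) ∨ IsUnit (a 1) ∨ IsUnit (a 2)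

/-- The bilinear pairing between a line and a point. -/
def dot {R : Type*} [CommRing R] (l a : Fin 3 → R) : R :=
  l 0 * a 0 + l 1 * a 1 + l 2 * a 2

/-- The points (or lines) represented by `a` and `b` are apart from each other. -/
def Apart {R : Type*} [CommRing R] (a b : Fin 3 → R) : Prop :=
  IsUnit (a 0 * b 1 - a 1 * b 0) ∨ IsUnit (a 1 * b 2 - a 2 * b 1) ∨
    IsUnit (a 2 * b 0 - a 0 * b 2)

open scoped Matrix

/-- Vectors in `R³` with vanishing cross product are proportional. -/
theorem smul_eq_smul_of_crossProduct_eq_zero {R : Type*} [CommRing R] {u v : Fin 3 → R}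
    (h : u ⨯₃ v = 0) (i : Fin 3) : u i • v = v i • u := by
  simp only [cross_apply, Matrix.cons_eq_zero_iff, sub_eq_zero] at h
  ext k
  fin_cases i <;> fin_cases k <;> simp <;> grind

theorem dot_eq_dotProduct {R : Type*} [CommRing R] (l a : Fin 3 → R) : dot l a = l ⬝ᵥ a := by
  rw [Matrix.vec3_dotProduct, dot]

theorem apart_iff_exists_isUnit_crossProduct {R : Type*} [CommRing R] {a b : Fin 3 → R} :
    Apart a b ↔ ∃ i, IsUnit ((a ⨯₃ b) i) := by
  simp [Apart, Fin.exists_fin_succ, cross_apply]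
  tauto

/-- If `A # B`, `l # m`, `A ∈ l`, `B ∈ l` and `B ∈ m`, then `A ∉ m`. -/
theorem outside_of_apart_lines
    {R : Type*} [CommRing R] (a b l m : Fin 3 → R)
    (ha : IsRep a) (hb : IsRep b) (hl : IsRep l) (hm : IsRep m)
    (hab : Apart a b) (hlm : Apart l m)
    (hal : dot l a = 0) (hbl : dot l b = 0) (hbm : dot m b = 0) :
    IsUnit (dot m a) := by
  simp only [dot_eq_dotProduct] at hal hbl hbm ⊢
  obtain ⟨i, hi⟩ := apart_iff_exists_isUnit_crossProduct.mp hab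
  obtain ⟨k, hk⟩ := apart_iff_exists_isUnit_crossProduct.mp hlm
  have hc : (a ⨯₃ b) ⨯₃ l = 0 := by
    rw [cross_cross_eq_smul_sub_smul, dotProduct_comm a, dotProduct_comm b, hal, hbl]
    simp
  have hcm : (a ⨯₃ b) ⨯₃ m = (m ⬝ᵥ a) • b := by
    rw [cross_cross_eq_smul_sub_smul, dotProduct_comm a, dotProduct_comm b, hbm]
    simp
  have key : (a ⨯₃ b) i • (l ⨯₃ m) = l i • (m ⬝ᵥ a) • b := by
    rw [← hcm, ← LinearMap.map_smul₂, ← LinearMap.map_smul₂,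
      smul_eq_smul_of_crossProduct_eq_zero hc]
  have hkey : (a ⨯₃ b) i * (l ⨯₃ m) k = l i * ((m ⬝ᵥ a) * b k) := congrFun key k
  exact isUnit_of_dvd_unit (Dvd.intro _ (by rw [hkey]; ring : (m ⬝ᵥ a) * (l i * b k) = _))
    (hi.mul hk)
end

section
/- Let R be a local ring. The projective plane over R satisfies that two points lying on two common lines force the points or the lines to coincide (i.e., for all a, b ∈ R³ representing points and λ, μ ∈ R³ representing lines, if λ·a = λ·b = 0 and μ·a = μ·b = 0, then b = u • a for some unit u of R, or μ = u • λ for some unit u of R) if and only if R is an integral domain, i.e. for all x, y ∈ R, x·y = 0 implies x = 0 or y = 0. -/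
theorem isRep_iff_exists {R : Type*} [CommRing R] {a : Fin 3 → R} :
    IsRep a ↔ ∃ i, IsUnit (a i) := by
  simp [IsRep, Fin.exists_fin_succ]

/-- Two representatives whose `2 × 2` minors all vanish represent the same point. -/
theorem exists_unit_smul_of_minors_eq_zero {R : Type*} [CommRing R] {a b : Fin 3 → R}
    (ha : IsRep a) (hb : IsRep b) (h : ∀ i j, a i * b j - a j * b i = 0) :
    ∃ u : Rˣ, b = (u : R) • a := by
  obtain ⟨i, v, hv⟩ := isRep_iff_exists.1 ha
  obtain ⟨j, hj⟩ := isRep_iff_exists.1 hb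
  have hb' (k : Fin 3) : b k = ((v⁻¹ : Rˣ) : R) * b i * a k := by
    have hk := h i k
    rw [← hv] at hk
    linear_combination ((v⁻¹ : Rˣ) : R) * hk - b k * v.inv_mul
  have hu : IsUnit (((v⁻¹ : Rˣ) : R) * b i) := by
    rw [hb' j] at hj
    exact isUnit_of_mul_isUnit_left hj
  exact ⟨hu.unit, funext hb'⟩

/-- A line through `a` and `b` is proportional to the vector of minors of `a` and `b`. -/
theorem minors_mul_eq_of_dot_eq_zero {R : Type*} [CommRing R] {a b l : Fin 3 → R}
    (ha : dot l a = 0) (hb : dot l b = 0) (i j : Fin 3) :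
    crossProduct a b i * l j = crossProduct a b j * l i := by
  simp only [dot] at ha hb
  fin_cases i <;> fin_cases j <;> simp [cross_apply]
  · linear_combination b 2 * ha - a 2 * hb
  · linear_combination a 1 * hb - b 1 * ha
  · linear_combination a 2 * hb - b 2 * ha
  · linear_combination b 0 * ha - a 0 * hb
  · linear_combination b 1 * ha - a 1 * hb
  · linear_combination a 0 * hb - b 0 * ha

/-- For a local ring `R`, the projective plane over `R` satisfies that two points lying on
two common lines force the points or the lines to coincide iff `R` is an integral domain. -/
theorem unique_incidence_iff_domain {R : Type*} [CommRing R] [IsLocalRing R] :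
    (∀ a b l m : Fin 3 → R, IsRep a → IsRep b → IsRep l → IsRep m →
      dot l a = 0 → dot l b = 0 → dot m a = 0 → dot m b = 0 →
      (∃ u : Rˣ, b = (u : R) • a) ∨ (∃ u : Rˣ, m = (u : R) • l)) ↔
      (∀ x y : R, x * y = 0 → x = 0 ∨ y = 0) := by
  constructor
  · intro h x y hxy
    rcases h ![0, 0, 1] ![x, 0, 1] ![0, 1, 0] ![y, 1, 0] (by simp [IsRep]) (by simp [IsRep])
      (by simp [IsRep]) (by simp [IsRep]) (by simp [dot]) (by simp [dot]) (by simp [dot])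
      (by simp [dot, mul_comm y x, hxy]) with ⟨u, hu⟩ | ⟨u, hu⟩
    · exact .inl (by simpa using congrFun hu 0)
    · exact .inr (by simpa using congrFun hu 0)
  · intro h a b l m ha hb hl hm hla hlb hma hmb
    by_cases hc : crossProduct a b = 0
    · left
      refine exists_unit_smul_of_minors_eq_zero ha hb fun i j => ?_
      have h0 := congrFun hc 0
      have h1 := congrFun hc 1
      have h2 := congrFun hc 2
      simp only [cross_apply, Matrix.cons_val, Pi.zero_apply] at h0 h1 h2
      fin_cases i <;> fin_cases j <;> dsimp <;> grind
    · right
      obtain ⟨k, hk⟩ := Function.ne_iff.1 hc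
      refine exists_unit_smul_of_minors_eq_zero hl hm fun i j => (h _ _ ?_).resolve_left hk
      linear_combination m j * minors_mul_eq_of_dot_eq_zero hla hlb k i
        + l k * minors_mul_eq_of_dot_eq_zero hma hmb i j
        - m i * minors_mul_eq_of_dot_eq_zero hla hlb k j
end

section
/- Desargues' theorem for projective planes over local rings: Let R be a local ring, let a, b, c, d ∈ R³ represent points A, B, C, D and let κ, λ, μ, ν ∈ R³ represent lines k, l, m, n of the projective plane over R. Suppose δ(k,l,A,B), δ(l,m,B,C), δ(m,n,C,D), δ(n,k,D,A) and δ(k,m,B,D) all hold; suppose l # n or A # C; suppose at least one of λ·a, λ·c, ν·a, ν·c is a unit; suppose at least one of κ·b, λ·b, μ·b is a unit; suppose at least one of μ·d, ν·d, κ·d is a unit; suppose at least one of κ·d, κ·a, κ·b is a unit; and suppose at least one of μ·b, μ·c, μ·d is a unit. Then δ(l,n,A,C) holds. (Here κ·a denotes κ₀a₀+κ₁a₁+κ₂a₂, etc.) -/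
/-- `Delta k l a b` : there exist a line `r` and a point `X` such that the points
`A`, `B`, `X` all lie on `r` and `X` lies on each of `k`, `l` and `r`. -/
def Delta {R : Type*} [CommRing R] (k l a b : Fin 3 → R) : Prop :=
  ∃ r X : Fin 3 → R, IsRep r ∧ IsRep X ∧
    dot r a = 0 ∧ dot r b = 0 ∧ dot r X = 0 ∧ dot k X = 0 ∧ dot l X = 0

open scoped Matrix

section

variable {R : Type*} [CommRing R] {k l a b r x : Fin 3 → R}

theorem dot_comm (l a : Fin 3 → R) : dot l a = dot a l := by
  unfold dot; ring

theorem Apart.symm (h : Apart a b) : Apart b a := by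
  have e (i j : Fin 3) : b i * a j - b j * a i = -(a i * b j - a j * b i) := by ring
  simpa only [Apart, e, IsUnit.neg_iff] using h

theorem apart_iff_isRep_cross : Apart a b ↔ IsRep (a ⨯₃ b) := by
  simp only [Apart, IsRep, cross_apply, Matrix.cons_val]
  tauto

theorem Delta.symm_lines (h : Delta k l a b) : Delta l k a b := by
  obtain ⟨r, x, hr, hx, ha, hb, hrx, hk, hl⟩ := h
  exact ⟨r, x, hr, hx, ha, hb, hrx, hl, hk⟩

theorem Delta.symm_points (h : Delta k l a b) : Delta k l b a := by
  obtain ⟨r, x, hr, hx, ha, hb, hrx, hk, hl⟩ := h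
  exact ⟨r, x, hr, hx, hb, ha, hrx, hk, hl⟩

/-- The relation `Delta` is self-dual: lines and points may be exchanged. -/
theorem Delta.dual (h : Delta k l a b) : Delta a b k l := by
  obtain ⟨r, x, hr, hx, ha, hb, hrx, hk, hl⟩ := h
  refine ⟨x, r, hx, hr, ?_, ?_, ?_, ?_, ?_⟩ <;> rwa [dot_comm]

/-- A cross product is a multiple of any unimodular vector orthogonal to both factors. -/
theorem exists_cross_eq_smul (hx : IsRep x) (hk : dot k x = 0) (hl : dot l x = 0) :
    ∃ s : R, k ⨯₃ l = s • x := by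
  have key (i : Fin 3) (hi : IsUnit (x i)) : ∃ s : R, k ⨯₃ l = s • x := by
    obtain ⟨y, hy⟩ := hi.exists_right_inv
    refine ⟨(k ⨯₃ l) i * y, ?_⟩
    unfold dot at hk hl
    ext j
    fin_cases i <;> fin_cases j <;> simp [cross_apply] at hy ⊢ <;> grind
  rcases hx with h | h | h
  exacts [key 0 h, key 1 h, key 2 h]

theorem dot_cross_cross (k l a b : Fin 3 → R) :
    dot (k ⨯₃ l) (a ⨯₃ b) = dot k a * dot l b - dot k b * dot l a := by
  simp only [dot, cross_apply, Matrix.cons_val]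
  ring

theorem Delta.dot_mul_dot (h : Delta k l a b) : dot k a * dot l b = dot k b * dot l a := by
  obtain ⟨r, x, hr, hx, ha, hb, hrx, hk, hl⟩ := h
  obtain ⟨s, hs⟩ := exists_cross_eq_smul hx hk hl
  obtain ⟨t, ht⟩ := exists_cross_eq_smul (k := a) (l := b) hr (dot_comm r a ▸ ha)
    (dot_comm r b ▸ hb)
  have e := dot_cross_cross k l a b
  rw [hs, ht] at e
  simp only [dot, Pi.smul_apply, smul_eq_mul] at e hrx ⊢
  linear_combination -e + s * t * hrx

theorem IsRep.of_cross [IsLocalRing R] (h : IsRep (a ⨯₃ b)) : IsRep a := by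
  have key {p q s t : R} (hu : IsUnit (p * q - s * t)) : IsUnit p ∨ IsUnit s := by
    rw [sub_eq_add_neg, ← neg_mul] at hu
    exact (IsLocalRing.isUnit_or_isUnit_of_isUnit_add hu).imp isUnit_of_mul_isUnit_left
      fun h => IsUnit.neg_iff s |>.1 (isUnit_of_mul_isUnit_left h)
  simp only [IsRep, cross_apply, Matrix.cons_val] at h ⊢
  rcases h with h | h | h <;> have := key h <;> tauto

theorem IsRep.smul {s : R} (hs : IsUnit s) (h : IsRep a) : IsRep (s • a) := by
  simp only [IsRep, Pi.smul_apply, smul_eq_mul, IsUnit.mul_iff, hs, true_and]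
  exact h

theorem delta_of_apart_of_isUnit [IsLocalRing R] (hkl : Apart k l) (hu : IsUnit (dot k a))
    (e : dot k a * dot l b = dot k b * dot l a) : Delta k l a b := by
  have hx := apart_iff_isRep_cross.1 hkl
  have hr : IsRep (a ⨯₃ (k ⨯₃ l)) := by
    refine .of_cross (b := k) ?_
    have : a ⨯₃ (k ⨯₃ l) ⨯₃ k = dot k a • (k ⨯₃ l) := by
      ext i
      fin_cases i <;> simp [dot, cross_apply] <;> ring
    exact this ▸ hx.smul hu
  refine ⟨a ⨯₃ (k ⨯₃ l), k ⨯₃ l, hr, hx, ?_, ?_, ?_, ?_, ?_⟩ <;>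
    simp only [dot, cross_apply, Matrix.cons_val] at e ⊢
  · ring
  · linear_combination -e
  all_goals ring

end

/-- If enough of the entries are units, the vanishing of five of the `2 × 2` minors of a matrix
with rows `k, l, m, n` and columns `a, b, c, d` forces a sixth to vanish. -/
theorem mul_eq_mul_of_minors {R : Type*} [CommRing R] {ka kb kd la lb lc mb mc md na nc nd : R}
    (h1 : ka * lb = kb * la) (h2 : lb * mc = lc * mb) (h3 : mc * nd = md * nc)
    (h4 : nd * ka = na * kd) (h5 : kb * md = kd * mb)
    (hB : IsUnit kb ∨ IsUnit lb ∨ IsUnit mb) (hD : IsUnit md ∨ IsUnit nd ∨ IsUnit kd)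
    (hK : IsUnit kd ∨ IsUnit ka ∨ IsUnit kb) (hM : IsUnit mb ∨ IsUnit mc ∨ IsUnit md) :
    la * nc = lc * na := by
  simp only [isUnit_iff_exists_inv] at hB hD hK hM
  rcases hB with ⟨x, hx⟩ | ⟨x, hx⟩ | ⟨x, hx⟩ <;> rcases hD with ⟨y, hy⟩ | ⟨y, hy⟩ | ⟨y, hy⟩ <;>
  rcases hK with ⟨z, hz⟩ | ⟨z, hz⟩ | ⟨z, hz⟩ <;> rcases hM with ⟨w, hw⟩ | ⟨w, hw⟩ | ⟨w, hw⟩ <;> grind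

/-- Desargues' theorem for projective planes over local rings. -/
theorem desargues {R : Type*} [CommRing R] [IsLocalRing R]
    (a b c d k l m n : Fin 3 → R)
    (ha : IsRep a) (hb : IsRep b) (hc : IsRep c) (hd : IsRep d)
    (hk : IsRep k) (hl : IsRep l) (hm : IsRep m) (hn : IsRep n)
    (h1 : Delta k l a b) (h2 : Delta l m b c) (h3 : Delta m n c d)
    (h4 : Delta n k d a) (h5 : Delta k m b d)
    (hap : Apart l n ∨ Apart a c)
    (hAC : IsUnit (dot l a) ∨ IsUnit (dot l c) ∨ IsUnit (dot n a) ∨ IsUnit (dot n c))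
    (hB : IsUnit (dot k b) ∨ IsUnit (dot l b) ∨ IsUnit (dot m b))
    (hD : IsUnit (dot m d) ∨ IsUnit (dot n d) ∨ IsUnit (dot k d))
    (hK : IsUnit (dot k d) ∨ IsUnit (dot k a) ∨ IsUnit (dot k b))
    (hM : IsUnit (dot m b) ∨ IsUnit (dot m c) ∨ IsUnit (dot m d)) :
    Delta l n a c := by
  have e := mul_eq_mul_of_minors h1.dot_mul_dot h2.dot_mul_dot h3.dot_mul_dot h4.dot_mul_dot
    h5.dot_mul_dot hB hD hK hM
  rcases hap with h | h
  · rcases hAC with u | u | u | u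
    · exact delta_of_apart_of_isUnit h u e
    · exact (delta_of_apart_of_isUnit h u e.symm).symm_points
    · exact (delta_of_apart_of_isUnit h.symm u (by linear_combination -e)).symm_lines
    · exact (delta_of_apart_of_isUnit h.symm u (by linear_combination e)).symm_lines.symm_points
  · simp only [dot_comm _ a, dot_comm _ c] at hAC e
    rcases hAC with u | u | u | u
    · exact (delta_of_apart_of_isUnit h u (by linear_combination e)).dual
    · exact (delta_of_apart_of_isUnit h.symm u (by linear_combination -e)).symm_lines.dual
    · exact (delta_of_apart_of_isUnit h u (by linear_combination -e)).symm_points.dual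
    · exact (delta_of_apart_of_isUnit h.symm u
        (by linear_combination e)).symm_lines.symm_points.dual
end

section
/- Let R be a local ring and let (a,b,c,d) and (a',b',c',d') be two quadruples of vectors in R³ each representing four points of the projective plane over R in general position (each of the four determinants of 3×3 matrices formed from three of the four vectors of the quadruple is a unit). Then there exist an invertible 3×3 matrix M over R and units r₁, r₂, r₃, r₄ of R such that M·a = r₁•a', M·b = r₂•b', M·c = r₃•c' and M·d = r₄•d'; moreover M is unique up to a unit scalar: any invertible 3×3 matrix N over R with N·a, N·b, N·c, N·d unit multiples of a', b', c', d' respectively satisfies N = u•M for some unit u of R. (Hence the quadruples of points in general position form a torsor under the projective general linear group of R.) -/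
/-- The determinant of the `3 × 3` matrix with columns `a`, `b`, `c`. -/
def cdet {R : Type*} [CommRing R] (a b c : Fin 3 → R) : R :=
  ((Matrix.of ![a, b, c]).transpose).det

/-- The four points represented by `a`, `b`, `c`, `d` are in general position. -/
def GenPos {R : Type*} [CommRing R] (a b c d : Fin 3 → R) : Prop :=
  IsUnit (cdet a b c) ∧ IsUnit (cdet a b d) ∧ IsUnit (cdet a c d) ∧ IsUnit (cdet b c d)

/-- The matrix with columns `a`, `b`, `c` sends a coordinate vector to the corresponding
linear combination of its columns. -/
theorem transpose_of_mulVec {R : Type*} [CommRing R] (a b c v : Fin 3 → R) :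
    (Matrix.of ![a, b, c]).transpose.mulVec v = v 0 • a + v 1 • b + v 2 • c := by
  ext i
  simp [Matrix.mulVec, dotProduct, Fin.sum_univ_three]
  ring

theorem cdet_smul {R : Type*} [CommRing R] (a b c : Fin 3 → R) (x y z : R) :
    cdet (x • a) (y • b) (z • c) = x * y * z * cdet a b c := by
  simp [cdet, Matrix.det_fin_three]
  ring

/-- Vectors with unit determinant are linearly independent. -/
theorem coeff_eq_of_isUnit_cdet {R : Type*} [CommRing R] {a b c : Fin 3 → R}
    (h : IsUnit (cdet a b c)) {x y z x' y' z' : R}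
    (e : x • a + y • b + z • c = x' • a + y' • b + z' • c) :
    x = x' ∧ y = y' ∧ z = z' := by
  have hinj := Matrix.mulVec_injective_of_isUnit ((Matrix.isUnit_iff_isUnit_det _).2 h)
  have hv : ![x, y, z] = ![x', y', z'] := hinj (by simpa [transpose_of_mulVec] using e)
  exact ⟨congrFun hv 0, congrFun hv 1, congrFun hv 2⟩

/-- Matrices agreeing on three vectors with unit determinant are equal. -/
theorem matrix_ext_of_isUnit_cdet {R : Type*} [CommRing R] {a b c : Fin 3 → R}
    (h : IsUnit (cdet a b c)) {M N : Matrix (Fin 3) (Fin 3) R}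
    (ha : N.mulVec a = M.mulVec a) (hb : N.mulVec b = M.mulVec b)
    (hc : N.mulVec c = M.mulVec c) : N = M := by
  have hA : IsUnit (Matrix.of ![a, b, c]).transpose := (Matrix.isUnit_iff_isUnit_det _).2 h
  refine hA.mul_right_cancel (Matrix.ext_of_mulVec_single fun i => ?_)
  simp only [← Matrix.mulVec_mulVec, transpose_of_mulVec, Matrix.mulVec_add,
    Matrix.mulVec_smul, ha, hb, hc]

/-- For points in general position, the last one is a combination of the first three
with unit coefficients. -/
theorem GenPos.exists_units_combination {R : Type*} [CommRing R] {a b c d : Fin 3 → R}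
    (h : GenPos a b c d) :
    ∃ x y z : Rˣ, d = (x : R) • a + (y : R) • b + (z : R) • c := by
  obtain ⟨habc, habd, hacd, hbcd⟩ := h
  obtain ⟨v, hv⟩ := Matrix.mulVec_surjective_iff_isUnit.2
    ((Matrix.isUnit_iff_isUnit_det (Matrix.of ![a, b, c]).transpose).2 habc) d
  rw [transpose_of_mulVec] at hv
  subst hv
  have hx : cdet b c (v 0 • a + v 1 • b + v 2 • c) = v 0 * cdet a b c := by
    simp [cdet, Matrix.det_fin_three]; ring
  have hy : cdet a c (v 0 • a + v 1 • b + v 2 • c) = v 1 * -cdet a b c := by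
    simp [cdet, Matrix.det_fin_three]; ring
  have hz : cdet a b (v 0 • a + v 1 • b + v 2 • c) = v 2 * cdet a b c := by
    simp [cdet, Matrix.det_fin_three]; ring
  rw [hx] at hbcd
  rw [hy] at hacd
  rw [hz] at habd
  exact ⟨(isUnit_of_mul_isUnit_left hbcd).unit, (isUnit_of_mul_isUnit_left hacd).unit,
    (isUnit_of_mul_isUnit_left habd).unit, rfl⟩

/-- There is an invertible matrix with prescribed values, of unit determinant, at three
vectors of unit determinant. -/
theorem exists_matrix_of_isUnit_cdet {R : Type*} [CommRing R] {a b c a' b' c' : Fin 3 → R}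
    (h : IsUnit (cdet a b c)) (h' : IsUnit (cdet a' b' c')) :
    ∃ M : Matrix (Fin 3) (Fin 3) R, IsUnit M.det ∧
      M.mulVec a = a' ∧ M.mulVec b = b' ∧ M.mulVec c = c' := by
  set P := (Matrix.of ![a, b, c]).transpose with hP
  set Q := (Matrix.of ![a', b', c']).transpose with hQ
  have hPu : IsUnit P.det := h
  have hmul : Q * P⁻¹ * P = Q := Matrix.nonsing_inv_mul_cancel_right P Q hPu
  have hval (v : Fin 3 → R) : (Q * P⁻¹).mulVec (P.mulVec v) = Q.mulVec v := by
    rw [Matrix.mulVec_mulVec, hmul]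
  refine ⟨Q * P⁻¹, ?_, ?_, ?_, ?_⟩
  · rw [Matrix.det_mul]
    exact h'.mul (Matrix.isUnit_nonsing_inv_det P hPu)
  · simpa [hP, hQ, transpose_of_mulVec] using hval ![1, 0, 0]
  · simpa [hP, hQ, transpose_of_mulVec] using hval ![0, 1, 0]
  · simpa [hP, hQ, transpose_of_mulVec] using hval ![0, 0, 1]

/-- Given two quadruples of points of the projective plane over a local ring, each in
general position, there is an invertible matrix taking the first quadruple to the second
(up to unit scalars on each point), and this matrix is unique up to a unit scalar; hence
quadruples of points in general position form a torsor under the projective general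
linear group. -/
theorem general_position_torsor
    {R : Type*} [CommRing R] [IsLocalRing R]
    (a b c d a' b' c' d' : Fin 3 → R)
    (h : GenPos a b c d) (h' : GenPos a' b' c' d') :
    ∃ M : Matrix (Fin 3) (Fin 3) R, IsUnit M.det ∧
      (∃ r1 r2 r3 r4 : Rˣ,
        M.mulVec a = (r1 : R) • a' ∧ M.mulVec b = (r2 : R) • b' ∧
        M.mulVec c = (r3 : R) • c' ∧ M.mulVec d = (r4 : R) • d') ∧
      ∀ N : Matrix (Fin 3) (Fin 3) R, IsUnit N.det →
        (∃ s1 s2 s3 s4 : Rˣ,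
          N.mulVec a = (s1 : R) • a' ∧ N.mulVec b = (s2 : R) • b' ∧
          N.mulVec c = (s3 : R) • c' ∧ N.mulVec d = (s4 : R) • d') →
        ∃ u : Rˣ, N = (u : R) • M := by
  obtain ⟨x, y, z, hd⟩ := h.exists_units_combination
  obtain ⟨x', y', z', hd'⟩ := h'.exists_units_combination
  have hscaled : IsUnit (cdet (((x⁻¹ * x' : Rˣ) : R) • a') (((y⁻¹ * y' : Rˣ) : R) • b')
      (((z⁻¹ * z' : Rˣ) : R) • c')) := by
    rw [cdet_smul]
    exact (((Units.isUnit _).mul (Units.isUnit _)).mul (Units.isUnit _)).mul h'.1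
  obtain ⟨M, hM, hMa, hMb, hMc⟩ := exists_matrix_of_isUnit_cdet h.1 hscaled
  refine ⟨M, hM, ⟨x⁻¹ * x', y⁻¹ * y', z⁻¹ * z', 1, hMa, hMb, hMc, ?_⟩, ?_⟩
  · rw [hd, hd']
    simp [Matrix.mulVec_add, Matrix.mulVec_smul, hMa, hMb, hMc, smul_smul]
  · rintro N - ⟨s₁, s₂, s₃, s₄, hNa, hNb, hNc, hNd⟩
    rw [hd, hd'] at hNd
    simp only [Matrix.mulVec_add, Matrix.mulVec_smul, hNa, hNb, hNc, smul_add, smul_smul] at hNd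
    obtain ⟨e₁, e₂, e₃⟩ := coeff_eq_of_isUnit_cdet h'.1 hNd
    have hcoeff {t t' s : Rˣ} (e : (t : R) * s = s₄ * t') :
        (s : R) = s₄ * ((t⁻¹ * t' : Rˣ) : R) := by
      rw [Units.val_mul, mul_left_comm, ← e, Units.inv_mul_cancel_left]
    refine ⟨s₄, matrix_ext_of_isUnit_cdet h.1 ?_ ?_ ?_⟩
    · rw [hNa, Matrix.smul_mulVec, hMa, smul_smul, hcoeff e₁]
    · rw [hNb, Matrix.smul_mulVec, hMb, smul_smul, hcoeff e₂]
    · rw [hNc, Matrix.smul_mulVec, hMc, smul_smul, hcoeff e₃]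
end
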